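/- Let n, r be integers with 0 ≤ r ≤ n and let f : [0,1] → ℝ be (r+2) times continuously differentiable. Then ‖ (M_n f)^{(r)} − M_{n−r}(f^{(r)}) ‖ ≤ (r(r+1)/(n+2))·‖f^{(r)}‖ + ((n+3)/(4((n+3)² − r²)))·‖f^{(r+2)}‖ + ω(f^{(r)}, r(n−r)/((n+2)² − r²)). -/

import Mathlib

/-- Bernstein basis polynomial `p_{n,k}(x) = C(n,k) x^k (1-x)^{n-k}`. -/
noncomputable def bern (n k : ℕ) (x : ℝ) : ℝ :=
  (n.choose k : ℝ) * x ^ k * (1 - x) ^ (n - k)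

/-- Classical Durrmeyer operator
`M_n(f;x) = (n+1) Σ_{k=0}^n p_{n,k}(x) ∫₀¹ p_{n,k}(t) f(t) dt`. -/
noncomputable def durrmeyer (n : ℕ) (f : ℝ → ℝ) (x : ℝ) : ℝ :=
  ((n : ℝ) + 1) * ∑ k ∈ Finset.range (n + 1),
    bern n k x * ∫ t in (0:ℝ)..1, bern n k t * f t

/-- Supremum norm on `[0,1]`. -/
noncomputable def supNorm (g : ℝ → ℝ) : ℝ :=
  ⨆ x : Set.Icc (0:ℝ) 1, |g x|

/-- First modulus of continuity on `[0,1]`. -/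
noncomputable def modCont (g : ℝ → ℝ) (δ : ℝ) : ℝ :=
  sSup {d : ℝ | ∃ x ∈ Set.Icc (0:ℝ) 1, ∃ y ∈ Set.Icc (0:ℝ) 1, |x - y| ≤ δ ∧ d = |g x - g y|}

lemma bern_eq_eval (n k : ℕ) (x : ℝ) : bern n k x = (bernsteinPolynomial ℝ n k).eval x := by
  simp [bern, bernsteinPolynomial]

lemma bern_nonneg (n k : ℕ) {x : ℝ} (hx : x ∈ Set.Icc (0:ℝ) 1) : 0 ≤ bern n k x := by
  have h0 := hx.1
  have h1 : 0 ≤ 1 - x := sub_nonneg.2 hx.2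
  unfold bern
  positivity

lemma bern_eq_zero_of_lt {n k : ℕ} (h : n < k) (x : ℝ) : bern n k x = 0 := by
  simp [bern, Nat.choose_eq_zero_of_lt h]

lemma continuous_bern (n k : ℕ) : Continuous (bern n k) := by
  unfold bern
  fun_prop

lemma sum_bern (n : ℕ) (x : ℝ) : ∑ k ∈ Finset.range (n + 1), bern n k x = 1 := by
  simp only [bern_eq_eval]
  rw [← Polynomial.eval_finsetSum, bernsteinPolynomial.sum, Polynomial.eval_one]

lemma hasDerivAt_bern_succ (n k : ℕ) (x : ℝ) :
    HasDerivAt (bern (n + 1) (k + 1)) ((n + 1) * (bern n k x - bern n (k + 1) x)) x := by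
  have h := (bernsteinPolynomial ℝ (n + 1) (k + 1)).hasDerivAt x
  rw [bernsteinPolynomial.derivative_succ_aux] at h
  simpa [bern_eq_eval, funext (bern_eq_eval (n + 1) (k + 1))] using h

lemma hasDerivAt_bern_zero (n : ℕ) (x : ℝ) :
    HasDerivAt (bern (n + 1) 0) (-((n + 1) * bern n 0 x)) x := by
  have h := (bernsteinPolynomial ℝ (n + 1) 0).hasDerivAt x
  rw [bernsteinPolynomial.derivative_zero] at h
  simpa [bern_eq_eval, funext (bern_eq_eval (n + 1) 0), neg_add, add_mul, sub_mul] using h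

lemma hasDerivAt_sum_bern (m : ℕ) (a : ℕ → ℝ) (x : ℝ) :
    HasDerivAt (fun y => ∑ k ∈ Finset.range (m + 1 + 1), bern (m + 1) k y * a k)
      ((m + 1) * ∑ k ∈ Finset.range (m + 1), bern m k x * (a (k + 1) - a k)) x := by
  have h : HasDerivAt (fun y => ∑ k ∈ Finset.range (m + 1), bern (m + 1) (k + 1) y * a (k + 1)
        + bern (m + 1) 0 y * a 0)
      (∑ k ∈ Finset.range (m + 1), (m + 1) * (bern m k x - bern m (k + 1) x) * a (k + 1)
        + -((m + 1) * bern m 0 x) * a 0) x :=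
    (HasDerivAt.fun_sum fun k _ => (hasDerivAt_bern_succ m k x).mul_const _).add
      ((hasDerivAt_bern_zero m x).mul_const _)
  have hshift : ∑ k ∈ Finset.range (m + 1), bern m (k + 1) x * a (k + 1) + bern m 0 x * a 0
      = ∑ k ∈ Finset.range (m + 1), bern m k x * a k := by
    rw [← Finset.sum_range_succ' (fun k => bern m k x * a k), Finset.sum_range_succ,
      bern_eq_zero_of_lt (Nat.lt_succ_self m)]
    simp
  simp only [Finset.sum_range_succ' _ (m + 1)]
  convert h using 1
  simp only [mul_sub, sub_mul, Finset.sum_sub_distrib, mul_assoc, ← Finset.mul_sum]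
  rw [← hshift]
  ring

lemma integral_bern_succ_sub (n k : ℕ) (hk : k + 1 ≤ n) {g : ℝ → ℝ} (hg : ContDiff ℝ 1 g) :
    (∫ t in (0:ℝ)..1, bern n (k + 1) t * g t) - ∫ t in (0:ℝ)..1, bern n k t * g t
      = 1 / ((n : ℝ) + 1) * ∫ t in (0:ℝ)..1, bern (n + 1) (k + 1) t * deriv g t := by
  have hg' : Continuous (deriv g) := hg.continuous_deriv le_rfl
  have hgc := hg.continuous
  have hb := continuous_bern n k
  have hb' := continuous_bern n (k + 1)
  have h := intervalIntegral.integral_mul_deriv_eq_deriv_mul (a := 0) (b := 1)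
    (fun x _ => hasDerivAt_bern_succ n k x)
    (fun x _ => (hg.differentiable one_ne_zero x).hasDerivAt)
    (Continuous.intervalIntegrable (by fun_prop) _ _) (hg'.intervalIntegrable _ _)
  rw [h, ← intervalIntegral.integral_sub (Continuous.intervalIntegrable (by fun_prop) _ _)
    (Continuous.intervalIntegrable (by fun_prop) _ _)]
  have h0 : bern (n + 1) (k + 1) 0 = 0 := by simp [bern]
  have h1 : bern (n + 1) (k + 1) 1 = 0 := by
    have : n - k ≠ 0 := by omega
    simp [bern, this]
  simp only [h0, h1, mul_assoc, intervalIntegral.integral_const_mul]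
  have hn : (n : ℝ) + 1 ≠ 0 := by positivity
  have hneg : ∫ t in (0:ℝ)..1, (bern n (k + 1) t * g t - bern n k t * g t)
      = -∫ t in (0:ℝ)..1, (bern n k t - bern n (k + 1) t) * g t := by
    rw [← intervalIntegral.integral_neg]
    congr 1
    ext t
    ring
  rw [hneg]
  field_simp
  ring

lemma integral_bern (n k : ℕ) (hk : k ≤ n) :
    ∫ t in (0:ℝ)..1, bern n k t = 1 / ((n : ℝ) + 1) := by
  induction k with
  | zero =>
    have : ∀ t : ℝ, bern n 0 t = (1 - t) ^ n := by simp [bern]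
    simp only [this]
    rw [intervalIntegral.integral_comp_sub_left (fun t : ℝ => t ^ n) 1]
    simp [integral_pow]
  | succ k ih =>
    have h := integral_bern_succ_sub n k hk (contDiff_const (c := (1:ℝ)))
    simp only [mul_one, deriv_const, mul_zero, intervalIntegral.integral_zero] at h
    rw [← ih (by omega)]
    linarith

lemma mul_bern (n k : ℕ) (t : ℝ) :
    t * bern n k t = ((k : ℝ) + 1) / ((n : ℝ) + 1) * bern (n + 1) (k + 1) t := by
  have h : ((n : ℝ) + 1) * n.choose k = (n + 1).choose (k + 1) * ((k : ℝ) + 1) := by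
    exact_mod_cast Nat.add_one_mul_choose_eq n k
  have hn : (n : ℝ) + 1 ≠ 0 := by positivity
  simp only [bern, Nat.add_sub_add_right]
  field_simp
  linear_combination t ^ (k + 1) * (1 - t) ^ (n - k) * h

lemma integral_id_mul_bern (n k : ℕ) (hk : k ≤ n) :
    ∫ t in (0:ℝ)..1, t * bern n k t = ((k : ℝ) + 1) / (((n : ℝ) + 1) * ((n : ℝ) + 2)) := by
  simp only [mul_bern, intervalIntegral.integral_const_mul]
  rw [integral_bern _ _ (by omega)]
  push_cast
  field_simp
  ring

lemma integral_sq_mul_bern (n k : ℕ) (hk : k ≤ n) :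
    ∫ t in (0:ℝ)..1, t ^ 2 * bern n k t =
      ((k : ℝ) + 1) * ((k : ℝ) + 2) / (((n : ℝ) + 1) * ((n : ℝ) + 2) * ((n : ℝ) + 3)) := by
  have : ∀ t : ℝ, t ^ 2 * bern n k t
      = ((k : ℝ) + 1) / ((n : ℝ) + 1) * (t * bern (n + 1) (k + 1) t) := by
    intro t
    rw [pow_two, mul_assoc, mul_bern]
    ring
  simp only [this, intervalIntegral.integral_const_mul]
  rw [integral_id_mul_bern _ _ (by omega)]
  push_cast
  field_simp
  ring

/-- A second order Taylor estimate on `[0,1]`. -/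
lemma abs_sub_taylor_le {g : ℝ → ℝ} (hg : ContDiff ℝ 2 g) {K : ℝ}
    (hK : ∀ t ∈ Set.Icc (0:ℝ) 1, |iteratedDeriv 2 g t| ≤ K) {μ t : ℝ}
    (hμ : μ ∈ Set.Icc (0:ℝ) 1) (ht : t ∈ Set.Icc (0:ℝ) 1) :
    |g t - (g μ + deriv g μ * (t - μ))| ≤ K / 2 * (t - μ) ^ 2 := by
  rcases eq_or_ne μ t with rfl | hne
  · simp
  obtain ⟨s, hs, h⟩ := taylor_mean_remainder_lagrange_iteratedDeriv (n := 1) hne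
    (f := g) (by exact_mod_cast hg.contDiffOn)
  have hs01 : s ∈ Set.Icc (0:ℝ) 1 := Set.uIcc_subset_Icc hμ ht (Set.uIoo_subset_uIcc_self hs)
  have hd : derivWithin g (Set.uIcc μ t) μ = deriv g μ :=
    (hg.differentiable two_ne_zero μ).derivWithin
      (uniqueDiffOn_uIcc hne μ Set.left_mem_uIcc)
  rw [taylorWithinEval_succ, taylor_within_zero_eval, iteratedDerivWithin_one, hd] at h
  simp only [CharP.cast_eq_zero, zero_add, Nat.factorial_zero, Nat.cast_one, pow_one,
    smul_eq_mul] at h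
  have h' : g t - (g μ + deriv g μ * (t - μ)) = iteratedDeriv 2 g s * (t - μ) ^ 2 / 2 := by
    norm_num at h
    linarith
  rw [h', abs_div, abs_mul, abs_two, abs_of_nonneg (sq_nonneg (t - μ))]
  have := mul_le_mul_of_nonneg_right (hK s hs01) (sq_nonneg (t - μ))
  linarith

/-- The Beta-type average of `g` against `bern n k` is close to the value of `g` at its mean. -/
lemma abs_integral_bern_mul_sub_le {g : ℝ → ℝ} (hg : ContDiff ℝ 2 g) {K : ℝ}
    (hK : ∀ t ∈ Set.Icc (0:ℝ) 1, |iteratedDeriv 2 g t| ≤ K) (n k : ℕ) (hk : k ≤ n) :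
    |((n : ℝ) + 1) * (∫ t in (0:ℝ)..1, bern n k t * g t) - g (((k : ℝ) + 1) / ((n : ℝ) + 2))|
      ≤ K / (8 * ((n : ℝ) + 3)) := by
  set μ : ℝ := ((k : ℝ) + 1) / ((n : ℝ) + 2) with hμdef
  have hkn : (k : ℝ) ≤ n := by exact_mod_cast hk
  have hμ : μ ∈ Set.Icc (0:ℝ) 1 :=
    ⟨by positivity, by rw [hμdef, div_le_one (by positivity)]; linarith⟩
  have hK0 : 0 ≤ K := (abs_nonneg _).trans (hK μ hμ)
  have hgc := hg.continuous
  have hb := continuous_bern n k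
  have hint : ∀ {φ : ℝ → ℝ}, Continuous φ → IntervalIntegrable φ MeasureTheory.volume 0 1 :=
    fun h => h.intervalIntegrable _ _
  have hmean : ∫ t in (0:ℝ)..1, bern n k t * (g t - (g μ + deriv g μ * (t - μ)))
      = (∫ t in (0:ℝ)..1, bern n k t * g t) - 1 / ((n : ℝ) + 1) * g μ := by
    have : ∀ t, bern n k t * (g t - (g μ + deriv g μ * (t - μ))) = bern n k t * g t
        - ((g μ - deriv g μ * μ) * bern n k t + deriv g μ * (t * bern n k t)) := by
      intro t; ring
    simp only [this]
    rw [intervalIntegral.integral_sub (hint (by fun_prop)) (hint (by fun_prop)),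
      intervalIntegral.integral_add (hint (by fun_prop)) (hint (by fun_prop)),
      intervalIntegral.integral_const_mul, intervalIntegral.integral_const_mul,
      integral_bern n k hk, integral_id_mul_bern n k hk, hμdef]
    field_simp
    ring
  have hvar : ∫ t in (0:ℝ)..1, bern n k t * (K / 2 * (t - μ) ^ 2)
      = K / 2 * (((k : ℝ) + 1) * ((n : ℝ) - k + 1)
          / (((n : ℝ) + 1) * ((n : ℝ) + 2) ^ 2 * ((n : ℝ) + 3))) := by
    have : ∀ t, bern n k t * (K / 2 * (t - μ) ^ 2) = K / 2 * (t ^ 2 * bern n k t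
        - 2 * μ * (t * bern n k t) + μ ^ 2 * bern n k t) := by
      intro t; ring
    simp only [this]
    rw [intervalIntegral.integral_const_mul,
      intervalIntegral.integral_add (hint (by fun_prop)) (hint (by fun_prop)),
      intervalIntegral.integral_sub (hint (by fun_prop)) (hint (by fun_prop)),
      intervalIntegral.integral_const_mul, intervalIntegral.integral_const_mul,
      integral_bern n k hk, integral_id_mul_bern n k hk, integral_sq_mul_bern n k hk, hμdef]
    field_simp
    ring
  have hbound : |∫ t in (0:ℝ)..1, bern n k t * (g t - (g μ + deriv g μ * (t - μ)))|
      ≤ ∫ t in (0:ℝ)..1, bern n k t * (K / 2 * (t - μ) ^ 2) := by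
    refine (intervalIntegral.abs_integral_le_integral_abs zero_le_one).trans
      (intervalIntegral.integral_mono_on zero_le_one (hint (by fun_prop)) (hint (by fun_prop)) ?_)
    intro t ht
    rw [abs_mul, abs_of_nonneg (bern_nonneg n k ht)]
    exact mul_le_mul_of_nonneg_left (abs_sub_taylor_le hg hK hμ ht) (bern_nonneg n k ht)
  rw [hmean, hvar] at hbound
  have hn : (0:ℝ) < (n : ℝ) + 1 := by positivity
  have heq : ((n : ℝ) + 1) * (∫ t in (0:ℝ)..1, bern n k t * g t) - g μ
      = ((n : ℝ) + 1) * ((∫ t in (0:ℝ)..1, bern n k t * g t) - 1 / ((n : ℝ) + 1) * g μ) := by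
    field_simp
  rw [heq, abs_mul, abs_of_pos hn]
  refine (mul_le_mul_of_nonneg_left hbound hn.le).trans ?_
  have hfrac : ((k : ℝ) + 1) * ((n : ℝ) - k + 1) / ((n : ℝ) + 2) ^ 2 ≤ 1 / 4 := by
    rw [div_le_div_iff₀ (by positivity) (by norm_num)]
    nlinarith [sq_nonneg (((k : ℝ) + 1) - ((n : ℝ) - k + 1))]
  calc ((n : ℝ) + 1) * (K / 2 * (((k : ℝ) + 1) * ((n : ℝ) - k + 1)
          / (((n : ℝ) + 1) * ((n : ℝ) + 2) ^ 2 * ((n : ℝ) + 3))))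
      = K / (2 * ((n : ℝ) + 3)) * (((k : ℝ) + 1) * ((n : ℝ) - k + 1) / ((n : ℝ) + 2) ^ 2) := by
        field_simp
    _ ≤ K / (2 * ((n : ℝ) + 3)) * (1 / 4) := mul_le_mul_of_nonneg_left hfrac (by positivity)
    _ = K / (8 * ((n : ℝ) + 3)) := by
        field_simp
        ring

/-- The factor `∏_{i<r} (n-i)/(n+2+i)` occurring in the `r`-th derivative of `durrmeyer n f`. -/
noncomputable def durrmeyerCoeff (n r : ℕ) : ℝ :=
  ∏ i ∈ Finset.range r, (((n : ℝ) - i) / ((n : ℝ) + 2 + i))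

lemma durrmeyerCoeff_mem_Icc (n r : ℕ) (hr : r ≤ n) : durrmeyerCoeff n r ∈ Set.Icc (0:ℝ) 1 := by
  have h : ∀ i ∈ Finset.range r, 0 ≤ ((n : ℝ) - i) / ((n : ℝ) + 2 + i) := by
    intro i hi
    have : (i : ℝ) ≤ n := by exact_mod_cast (Finset.mem_range.1 hi).le.trans hr
    exact div_nonneg (by linarith) (by positivity)
  refine ⟨Finset.prod_nonneg h, Finset.prod_le_one h fun i _ => ?_⟩
  rw [div_le_one (by positivity)]
  have : (0:ℝ) ≤ i := by positivity
  linarith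

lemma one_sub_durrmeyerCoeff_le (n r : ℕ) (hr : r ≤ n) :
    1 - durrmeyerCoeff n r ≤ (r : ℝ) * ((r : ℝ) + 1) / ((n : ℝ) + 2) := by
  induction r with
  | zero => simp [durrmeyerCoeff]
  | succ r ih =>
    have ih := ih (by omega)
    obtain ⟨h0, h1⟩ := durrmeyerCoeff_mem_Icc n r (by omega)
    have hstep : durrmeyerCoeff n (r + 1)
        = durrmeyerCoeff n r - durrmeyerCoeff n r * ((2 * r + 2) / ((n : ℝ) + 2 + r)) := by
      rw [durrmeyerCoeff, Finset.prod_range_succ, ← durrmeyerCoeff]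
      field_simp
      ring
    have hle : durrmeyerCoeff n r * ((2 * r + 2) / ((n : ℝ) + 2 + r))
        ≤ (2 * r + 2) / ((n : ℝ) + 2) := by
      refine (mul_le_of_le_one_left (by positivity) h1).trans ?_
      exact div_le_div_of_nonneg_left (by positivity) (by positivity) (by simp)
    have : ((r + 1 : ℕ) : ℝ) * (((r + 1 : ℕ) : ℝ) + 1) / ((n : ℝ) + 2)
        = (r : ℝ) * ((r : ℝ) + 1) / ((n : ℝ) + 2) + (2 * r + 2) / ((n : ℝ) + 2) := by
      push_cast
      field_simp
      ring
    linarith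

/-- Closed form of the derivatives of the Durrmeyer operator. -/
lemma iteratedDeriv_durrmeyer (n r m : ℕ) (hm : m + r = n) {f : ℝ → ℝ} (hf : ContDiff ℝ r f)
    (x : ℝ) :
    iteratedDeriv r (durrmeyer n f) x = durrmeyerCoeff n r * ∑ k ∈ Finset.range (m + 1),
      bern m k x * (((n : ℝ) + r + 1) *
        ∫ t in (0:ℝ)..1, bern (n + r) (k + r) t * iteratedDeriv r f t) := by
  induction r generalizing m x with
  | zero =>
    obtain rfl : m = n := by omega
    simp only [iteratedDeriv_zero, durrmeyer, durrmeyerCoeff, Finset.range_zero, Finset.prod_empty,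
      one_mul, Finset.mul_sum, add_zero, Nat.cast_zero]
    exact Finset.sum_congr rfl fun k _ => by ring
  | succ r ih =>
    have hfr : ContDiff ℝ r f := hf.of_le (by exact_mod_cast Nat.le_succ r)
    have hg : ContDiff ℝ 1 (iteratedDeriv r f) := by
      rw [iteratedDeriv_eq_iterate]
      exact ContDiff.iterate_deriv' 1 r (by rwa [add_comm])
    rw [iteratedDeriv_succ, funext fun y => ih (m + 1) (by omega) hfr y,
      ((hasDerivAt_sum_bern m _ x).const_mul _).deriv, durrmeyerCoeff, durrmeyerCoeff,
      Finset.prod_range_succ, mul_assoc]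
    congr 1
    rw [Finset.mul_sum, Finset.mul_sum]
    refine Finset.sum_congr rfl fun k hk => ?_
    have hk' := Finset.mem_range.1 hk
    have h := integral_bern_succ_sub (n + r) (k + r) (by omega) hg
    rw [← iteratedDeriv_succ] at h
    rw [← mul_sub, add_right_comm k 1 r, h, ← add_assoc, ← add_assoc]
    have hn : (n : ℝ) = m + r + 1 := by rw [← hm]; push_cast; ring
    rw [hn]
    push_cast
    rw [hn]
    field_simp
    ring

lemma abs_le_supNorm {g : ℝ → ℝ} (hg : Continuous g) {x : ℝ} (hx : x ∈ Set.Icc (0:ℝ) 1) :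
    |g x| ≤ supNorm g := by
  have hb : BddAbove (Set.range fun y : Set.Icc (0:ℝ) 1 => |g y|) :=
    isCompact_range (by fun_prop) |>.bddAbove
  exact le_ciSup hb ⟨x, hx⟩

lemma abs_sub_le_modCont {g : ℝ → ℝ} (hg : Continuous g) {δ x y : ℝ} (hx : x ∈ Set.Icc (0:ℝ) 1)
    (hy : y ∈ Set.Icc (0:ℝ) 1) (h : |x - y| ≤ δ) : |g x - g y| ≤ modCont g δ := by
  refine le_csSup ⟨supNorm g + supNorm g, ?_⟩ ⟨x, hx, y, hy, h, rfl⟩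
  rintro _ ⟨a, ha, b, hb, -, rfl⟩
  exact (abs_sub _ _).trans (add_le_add (abs_le_supNorm hg ha) (abs_le_supNorm hg hb))

lemma abs_integral_bern_mul_le {g : ℝ → ℝ} (hg : Continuous g) (n k : ℕ) (hk : k ≤ n) :
    |((n : ℝ) + 1) * ∫ t in (0:ℝ)..1, bern n k t * g t| ≤ supNorm g := by
  have hb := continuous_bern n k
  have h : |∫ t in (0:ℝ)..1, bern n k t * g t| ≤ ∫ t in (0:ℝ)..1, bern n k t * supNorm g := by
    refine (intervalIntegral.abs_integral_le_integral_abs zero_le_one).trans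
      (intervalIntegral.integral_mono_on zero_le_one
        (Continuous.intervalIntegrable (by fun_prop) _ _)
        (Continuous.intervalIntegrable (by fun_prop) _ _) fun t ht => ?_)
    rw [abs_mul, abs_of_nonneg (bern_nonneg n k ht)]
    exact mul_le_mul_of_nonneg_left (abs_le_supNorm hg ht) (bern_nonneg n k ht)
  rw [intervalIntegral.integral_mul_const, integral_bern n k hk] at h
  have hn : (0:ℝ) < (n : ℝ) + 1 := by positivity
  rw [abs_mul, abs_of_pos hn]
  refine (mul_le_mul_of_nonneg_left h hn.le).trans_eq ?_
  field_simp

lemma abs_sum_bern_mul_le (m : ℕ) {x : ℝ} (hx : x ∈ Set.Icc (0:ℝ) 1) (a : ℕ → ℝ) {C : ℝ}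
    (ha : ∀ k ≤ m, |a k| ≤ C) : |∑ k ∈ Finset.range (m + 1), bern m k x * a k| ≤ C := by
  calc |∑ k ∈ Finset.range (m + 1), bern m k x * a k|
      ≤ ∑ k ∈ Finset.range (m + 1), |bern m k x * a k| := Finset.abs_sum_le_sum_abs _ _
    _ ≤ ∑ k ∈ Finset.range (m + 1), bern m k x * C := by
        refine Finset.sum_le_sum fun k hk => ?_
        rw [abs_mul, abs_of_nonneg (bern_nonneg m k hx)]
        exact mul_le_mul_of_nonneg_left (ha k (Nat.lt_succ_iff.1 (Finset.mem_range.1 hk)))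
          (bern_nonneg m k hx)
    _ = C := by rw [← Finset.sum_mul, sum_bern, one_mul]

/-- Comparison of the averages of `g` against `bern (n + r) (k + r)` and `bern (n - r) k`. -/
lemma abs_integral_bern_sub_integral_bern_le {g : ℝ → ℝ} (hg : ContDiff ℝ 2 g) {n r m k : ℕ}
    (hm : m + r = n) (hk : k ≤ m) :
    |((n : ℝ) + r + 1) * (∫ t in (0:ℝ)..1, bern (n + r) (k + r) t * g t)
        - ((m : ℝ) + 1) * ∫ t in (0:ℝ)..1, bern m k t * g t| ≤
      ((n : ℝ) + 3) / (4 * (((n : ℝ) + 3) ^ 2 - (r : ℝ) ^ 2)) * supNorm (iteratedDeriv 2 g)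
        + modCont g ((r : ℝ) * ((n : ℝ) - (r : ℝ)) / (((n : ℝ) + 2) ^ 2 - (r : ℝ) ^ 2)) := by
  have hK : ∀ t ∈ Set.Icc (0:ℝ) 1, |iteratedDeriv 2 g t| ≤ supNorm (iteratedDeriv 2 g) :=
    fun t ht => abs_le_supNorm (hg.continuous_iteratedDeriv 2 le_rfl) ht
  have h1 := abs_integral_bern_mul_sub_le hg hK (n + r) (k + r) (by omega)
  have h2 := abs_integral_bern_mul_sub_le hg hK m k hk
  push_cast at h1
  have hn : (n : ℝ) = m + r := by rw [← hm]; push_cast; ring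
  have hkm : (k : ℝ) ≤ m := by exact_mod_cast hk
  have hk0 : (0:ℝ) ≤ k := by positivity
  have hr0 : (0:ℝ) ≤ r := by positivity
  have h3 : |g (((k : ℝ) + r + 1) / ((n : ℝ) + r + 2)) - g (((k : ℝ) + 1) / ((m : ℝ) + 2))|
      ≤ modCont g ((r : ℝ) * ((n : ℝ) - (r : ℝ)) / (((n : ℝ) + 2) ^ 2 - (r : ℝ) ^ 2)) := by
    refine abs_sub_le_modCont hg.continuous ⟨by positivity, ?_⟩ ⟨by positivity, ?_⟩ ?_
    · rw [div_le_one (by positivity)]; linarith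
    · rw [div_le_one (by positivity)]; linarith
    · have hd : ((n : ℝ) + 2) ^ 2 - (r : ℝ) ^ 2 = (n + r + 2) * (m + 2) := by rw [hn]; ring
      have he : ((k : ℝ) + r + 1) / ((n : ℝ) + r + 2) - ((k : ℝ) + 1) / ((m : ℝ) + 2)
          = r * (m - 2 * k) / ((n + r + 2) * (m + 2)) := by
        rw [hn]
        field_simp
        ring
      have hpos : (0:ℝ) < (n + r + 2) * (m + 2) := by positivity
      rw [hd, he, abs_div, abs_of_pos hpos, abs_mul, abs_of_nonneg hr0]
      refine div_le_div_of_nonneg_right (mul_le_mul_of_nonneg_left ?_ hr0) hpos.le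
      rw [abs_le]
      constructor <;> linarith
  have h4 : supNorm (iteratedDeriv 2 g) / (8 * ((n : ℝ) + r + 3))
      + supNorm (iteratedDeriv 2 g) / (8 * ((m : ℝ) + 3))
      = ((n : ℝ) + 3) / (4 * (((n : ℝ) + 3) ^ 2 - (r : ℝ) ^ 2))
        * supNorm (iteratedDeriv 2 g) := by
    have hd : ((n : ℝ) + 3) ^ 2 - (r : ℝ) ^ 2 = (n + r + 3) * (m + 3) := by rw [hn]; ring
    rw [hd, hn]
    field_simp
    ring
  rw [← h4]
  rw [abs_le] at *
  constructor <;> linarith [h1.1, h1.2, h2.1, h2.2, h3.1, h3.2]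

theorem durrmeyer_derivative_difference
    (n r : ℕ) (hr : r ≤ n)
    (f : ℝ → ℝ) (hf : ContDiff ℝ (r + 2 : ℕ) f) :
    ∀ x ∈ Set.Icc (0:ℝ) 1,
      |iteratedDeriv r (durrmeyer n f) x - durrmeyer (n - r) (iteratedDeriv r f) x| ≤
        (r : ℝ) * ((r : ℝ) + 1) / ((n : ℝ) + 2) * supNorm (iteratedDeriv r f)
          + ((n : ℝ) + 3) / (4 * (((n : ℝ) + 3) ^ 2 - (r : ℝ) ^ 2)) *
              supNorm (iteratedDeriv (r + 2) f)
          + modCont (iteratedDeriv r f)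
              ((r : ℝ) * ((n : ℝ) - (r : ℝ)) / (((n : ℝ) + 2) ^ 2 - (r : ℝ) ^ 2)) := by
  intro x hx
  obtain ⟨m, rfl⟩ := Nat.exists_eq_add_of_le' hr
  set n := m + r with hn
  have hg : ContDiff ℝ 2 (iteratedDeriv r f) := by
    rw [iteratedDeriv_eq_iterate]
    exact ContDiff.iterate_deriv' 2 r (by rwa [add_comm])
  have hgg : iteratedDeriv 2 (iteratedDeriv r f) = iteratedDeriv (r + 2) f := by
    simp only [iteratedDeriv_eq_iterate, ← Function.iterate_add_apply, add_comm]
  rw [iteratedDeriv_durrmeyer n r m rfl (hf.of_le (by exact_mod_cast Nat.le_add_right r 2)),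
    show n - r = m by omega]
  set g := iteratedDeriv r f
  obtain ⟨hc0, hc1⟩ := durrmeyerCoeff_mem_Icc n r hr
  have hc := one_sub_durrmeyerCoeff_le n r hr
  set F : ℕ → ℝ := fun k =>
    ((n : ℝ) + r + 1) * ∫ t in (0:ℝ)..1, bern (n + r) (k + r) t * g t
  set G : ℕ → ℝ := fun k => ((m : ℝ) + 1) * ∫ t in (0:ℝ)..1, bern m k t * g t
  have hG : durrmeyer m g x = ∑ k ∈ Finset.range (m + 1), bern m k x * G k := by
    rw [durrmeyer, Finset.mul_sum]
    exact Finset.sum_congr rfl fun k _ => by ring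
  have hF : |∑ k ∈ Finset.range (m + 1), bern m k x * F k| ≤ supNorm g := by
    refine abs_sum_bern_mul_le m hx F fun k hk => ?_
    have := abs_integral_bern_mul_le hg.continuous (n + r) (k + r) (by omega)
    push_cast at this
    exact this
  have hFG := abs_sum_bern_mul_le m hx (fun k => F k - G k) fun k hk =>
    abs_integral_bern_sub_integral_bern_le hg hn.symm hk
  have hsplit : durrmeyerCoeff n r * ∑ k ∈ Finset.range (m + 1), bern m k x * F k
        - durrmeyer m g x
      = -((1 - durrmeyerCoeff n r) * ∑ k ∈ Finset.range (m + 1), bern m k x * F k)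
        + ∑ k ∈ Finset.range (m + 1), bern m k x * (F k - G k) := by
    simp only [hG, mul_sub, Finset.sum_sub_distrib]
    ring
  rw [← hgg]
  calc _ = |_| := congrArg abs hsplit
    _ ≤ _ := abs_add_le _ _
    _ ≤ _ := by
      rw [add_assoc, abs_neg, abs_mul, abs_of_nonneg (sub_nonneg.2 hc1)]
      exact add_le_add (mul_le_mul hc hF (abs_nonneg _) (by positivity)) hFG
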